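/- Let k >= 1 be an integer, ell an integer with 0 <= ell <= k, r an integer, m = ell + 2r, and q real with 0 < q < 1. Then the Kac-Peterson and Verma-character bosonic forms of the Z_k parafermion character agree: (q;q)_inf^{-2} * [ ( sum_{i >= 0, j >= 0} - sum_{i < 0, j < 0} ) (-1)^i q^{(ell+1+(i+2j)(k+2))^2/(4(k+2)) - (m+ik)^2/(4k)} - ( sum_{i >= 0, j > 0} - sum_{i < 0, j <= 0} ) (-1)^i q^{(ell+1-(i+2j)(k+2))^2/(4(k+2)) - (m+ik)^2/(4k)} ] = q^{-(ell+2r)^2/(4k)} sum_{j in Z} q^{(k+2)(j + (ell+1)/(2(k+2)))^2} ( Vhat_{r-(k+2)j}(q) - Vhat_{r+ell+1+(k+2)j}(q) ). -/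

import Mathlib

open scoped BigOperators

noncomputable section

/-- Finite q-Pochhammer symbol `(a;q)_n`. -/
def qP (q a : ℝ) (n : ℕ) : ℝ := ∏ m ∈ Finset.range n, (1 - a * q ^ m)

/-- Infinite q-Pochhammer symbol `(a;q)_∞`. -/
def qPInf (q a : ℝ) : ℝ := ∏' m : ℕ, (1 - a * q ^ m)

/-- `1/(q;q)_n` for `n : ℤ`, equal to `0` for negative `n`. -/
def invQ (q : ℝ) (n : ℤ) : ℝ := if 0 ≤ n then (qP q q n.toNat)⁻¹ else 0

/-- Non-graded parafermion Verma character `V̂_t(q)`. -/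
def Vhat (q : ℝ) (t : ℤ) : ℝ :=
  ∑' j : ℕ, q ^ ((((j : ℤ) + t : ℤ)) : ℝ) * ((qP q q j)⁻¹ * invQ q ((j : ℤ) + t))

open Filter Topology

def aT (q : ℝ) (i : ℕ) : ℝ := (-1) ^ i * q ^ ((i + 1).choose 2) * (qP q q i)⁻¹
def bT (q : ℝ) (j : ℕ) : ℝ := q ^ j * (qP q q j)⁻¹

lemma qP_succ (q : ℝ) (n : ℕ) : qP q q (n + 1) = qP q q n * (1 - q ^ (n + 1)) := by
  unfold qP
  rw [Finset.prod_range_succ, pow_succ']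

lemma qP_pos {q : ℝ} (hq0 : 0 < q) (hq1 : q < 1) (n : ℕ) : 0 < qP q q n := by
  unfold qP
  apply Finset.prod_pos
  intro m _
  have : q ^ (m + 1) < 1 := pow_lt_one₀ hq0.le hq1 (by omega)
  rw [pow_succ'] at this
  linarith

lemma one_sub_pos {q : ℝ} (hq0 : 0 < q) (hq1 : q < 1) (n : ℕ) : 0 < 1 - q ^ (n + 1) := by
  have : q ^ (n + 1) < 1 := pow_lt_one₀ hq0.le hq1 (by omega)
  linarith

lemma aT_succ {q : ℝ} (hq0 : 0 < q) (hq1 : q < 1) (i : ℕ) :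
    aT q (i + 1) * (1 - q ^ (i + 1)) = - (aT q i * q ^ (i + 1)) := by
  have h1 := (qP_pos hq0 hq1 i).ne'
  have h2 := (one_sub_pos hq0 hq1 i).ne'
  unfold aT
  rw [qP_succ, Nat.choose_succ_succ' (i + 1) 1, Nat.choose_one_right, pow_add q (i + 1)]
  field_simp
  ring

lemma bT_succ {q : ℝ} (hq0 : 0 < q) (hq1 : q < 1) (i : ℕ) :
    bT q (i + 1) * (1 - q ^ (i + 1)) = q * bT q i := by
  have h1 := (qP_pos hq0 hq1 i).ne'
  have h2 := (one_sub_pos hq0 hq1 i).ne'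
  unfold bT
  rw [qP_succ]
  field_simp
  ring

lemma tends_pow {q : ℝ} (hq0 : 0 < q) (hq1 : q < 1) :
    Tendsto (fun n : ℕ => q ^ (n + 1)) atTop (𝓝 0) :=
  (tendsto_pow_atTop_nhds_zero_of_lt_one hq0.le hq1).comp (tendsto_add_atTop_nat 1)

lemma bT_pos {q : ℝ} (hq0 : 0 < q) (hq1 : q < 1) (i : ℕ) : 0 < bT q i := by
  have h1 := qP_pos hq0 hq1 i
  unfold bT
  positivity

lemma bT_summable {q : ℝ} (hq0 : 0 < q) (hq1 : q < 1) : Summable (bT q) := by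
  refine summable_of_ratio_test_tendsto_lt_one (l := q / (1 - 0)) (by simpa using hq1)
    (Eventually.of_forall fun i => (bT_pos hq0 hq1 i).ne') ?_
  have : (fun n => ‖bT q (n + 1)‖ / ‖bT q n‖) = fun n => q / (1 - q ^ (n + 1)) := by
    funext n
    have h1 := bT_pos hq0 hq1 n
    have h2 := bT_pos hq0 hq1 (n + 1)
    rw [Real.norm_of_nonneg h1.le, Real.norm_of_nonneg h2.le,
      div_eq_div_iff h1.ne' (one_sub_pos hq0 hq1 n).ne', bT_succ hq0 hq1]
  rw [this]
  exact tendsto_const_nhds.div (tendsto_const_nhds.sub (tends_pow hq0 hq1)) (by norm_num)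

lemma aT_ne {q : ℝ} (hq0 : 0 < q) (hq1 : q < 1) (i : ℕ) : aT q i ≠ 0 := by
  have h1 := qP_pos hq0 hq1 i
  unfold aT
  have : (-1 : ℝ) ^ i ≠ 0 := by simp
  positivity

lemma aT_summable {q : ℝ} (hq0 : 0 < q) (hq1 : q < 1) : Summable (aT q) := by
  refine summable_of_ratio_test_tendsto_lt_one (l := 0 / (1 - 0)) (by simp)
    (Eventually.of_forall fun i => aT_ne hq0 hq1 i) ?_
  have : (fun n => ‖aT q (n + 1)‖ / ‖aT q n‖) = fun n => q ^ (n + 1) / (1 - q ^ (n + 1)) := by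
    funext n
    have h1 := aT_ne hq0 hq1 n
    have h2 := one_sub_pos hq0 hq1 n
    rw [div_eq_div_iff (by simpa using h1) h2.ne']
    have h3 := congrArg norm (aT_succ hq0 hq1 n)
    rw [norm_neg, norm_mul, norm_mul, Real.norm_of_nonneg h2.le,
      Real.norm_of_nonneg (pow_pos hq0 _).le] at h3
    rw [h3, mul_comm]
  rw [this]
  exact (tends_pow hq0 hq1).div (tendsto_const_nhds.sub (tends_pow hq0 hq1)) (by norm_num)

lemma pow_pow_le {q : ℝ} (hq0 : 0 < q) (hq1 : q < 1) (n j : ℕ) : (q ^ n) ^ j ≤ 1 :=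
  pow_le_one₀ (by positivity) (pow_le_one₀ hq0.le hq1.le)

lemma sum_twist {q : ℝ} (hq0 : 0 < q) (hq1 : q < 1) {a : ℕ → ℝ} (ha : Summable a) (n : ℕ) :
    Summable fun j => a j * (q ^ n) ^ j := by
  refine Summable.of_norm_bounded ha.norm fun j => ?_
  rw [norm_mul, Real.norm_of_nonneg (by positivity : 0 ≤ (q ^ n) ^ j)]
  exact mul_le_of_le_one_right (norm_nonneg _) (pow_pow_le hq0 hq1 n j)

lemma lim_twist {q : ℝ} (hq0 : 0 < q) (hq1 : q < 1) {a : ℕ → ℝ} (ha : Summable a) :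
    Tendsto (fun n : ℕ => ∑' j, a j * (q ^ n) ^ j) atTop (𝓝 (a 0)) := by
  have := tendsto_tsum_of_dominated_convergence (𝓕 := atTop)
    (f := fun n j => a j * (q ^ n) ^ j) (g := fun j => if j = 0 then a 0 else 0)
    (bound := fun j => ‖a j‖) ha.norm ?_ ?_
  · simpa using this
  · intro j
    rcases Nat.eq_zero_or_pos j with rfl | hj
    · simp
    · have h := ((tendsto_pow_atTop_nhds_zero_of_lt_one hq0.le hq1).pow j).const_mul (a j)
      simpa [hj.ne'] using h
  · refine Eventually.of_forall fun n j => ?_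
    rw [norm_mul, Real.norm_of_nonneg (by positivity : 0 ≤ (q ^ n) ^ j)]
    exact mul_le_of_le_one_right (norm_nonneg _) (pow_pow_le hq0 hq1 n j)

def gS (q : ℝ) (n : ℕ) : ℝ := ∑' j, bT q j * (q ^ n) ^ j
def eS (q : ℝ) (n : ℕ) : ℝ := ∑' j, aT q j * (q ^ n) ^ j

lemma gS_succ {q : ℝ} (hq0 : 0 < q) (hq1 : q < 1) (n : ℕ) :
    gS q (n + 1) = (1 - q ^ (n + 1)) * gS q n := by
  have s1 := sum_twist hq0 hq1 (bT_summable hq0 hq1) n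
  have s2 := sum_twist hq0 hq1 (bT_summable hq0 hq1) (n + 1)
  have h : gS q n - gS q (n + 1) = q ^ (n + 1) * gS q n := by
    unfold gS
    rw [← s1.tsum_sub s2, (s1.sub s2).tsum_eq_zero_add, ← tsum_mul_left]
    simp only [pow_zero, sub_self, zero_add]
    refine tsum_congr fun j => ?_
    have := bT_succ hq0 hq1 j
    calc _ = bT q (j + 1) * (1 - q ^ (j + 1)) * (q ^ n) ^ (j + 1) := by ring
      _ = _ := by rw [this]; ring
  linarith

lemma eS_succ {q : ℝ} (hq0 : 0 < q) (hq1 : q < 1) (n : ℕ) :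
    eS q n = (1 - q ^ (n + 1)) * eS q (n + 1) := by
  have s1 := sum_twist hq0 hq1 (aT_summable hq0 hq1) n
  have s2 := sum_twist hq0 hq1 (aT_summable hq0 hq1) (n + 1)
  have h : eS q n - eS q (n + 1) = (-q ^ (n + 1)) * eS q (n + 1) := by
    unfold eS
    rw [← s1.tsum_sub s2, (s1.sub s2).tsum_eq_zero_add, ← tsum_mul_left]
    simp only [pow_zero, sub_self, zero_add]
    refine tsum_congr fun j => ?_
    have := aT_succ hq0 hq1 j
    calc _ = aT q (j + 1) * (1 - q ^ (j + 1)) * (q ^ n) ^ (j + 1) := by ring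
      _ = _ := by rw [this]; ring
  linarith

lemma gS_eq {q : ℝ} (hq0 : 0 < q) (hq1 : q < 1) (n : ℕ) : gS q n = qP q q n * gS q 0 := by
  induction n with
  | zero => simp [qP]
  | succ n ih => rw [gS_succ hq0 hq1, ih, qP_succ]; ring

lemma eS_eq {q : ℝ} (hq0 : 0 < q) (hq1 : q < 1) (n : ℕ) : qP q q n * eS q n = eS q 0 := by
  induction n with
  | zero => simp [qP]
  | succ n ih => rw [← ih, eS_succ hq0 hq1 n, qP_succ]; ring

lemma qP_tendsto {q : ℝ} (hq0 : 0 < q) (hq1 : q < 1) :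
    Tendsto (qP q q) atTop (𝓝 (qPInf q q)) := by
  have hs : Summable fun m : ℕ => -(q * q ^ m) :=
    ((summable_geometric_of_lt_one hq0.le hq1).mul_left q).neg
  have hm := (Real.multipliable_one_add_of_summable hs).tendsto_prod_tprod_nat
  simp only [← sub_eq_add_neg] at hm
  exact hm

lemma inf_gS {q : ℝ} (hq0 : 0 < q) (hq1 : q < 1) : qPInf q q * gS q 0 = 1 := by
  have h1 := (qP_tendsto hq0 hq1).mul_const (gS q 0)
  have h2 := lim_twist hq0 hq1 (bT_summable hq0 hq1)
  have h3 : (fun n => qP q q n * gS q 0) = fun n : ℕ => ∑' j, bT q j * (q ^ n) ^ j := by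
    funext n
    rw [← gS_eq hq0 hq1]; rfl
  rw [h3] at h1
  rw [tendsto_nhds_unique h1 h2]
  simp [bT, qP]

lemma inf_eS {q : ℝ} (hq0 : 0 < q) (hq1 : q < 1) (n : ℕ) :
    qPInf q q * (qP q q n)⁻¹ = eS q n := by
  have h2 := (qP_tendsto hq0 hq1).mul (lim_twist hq0 hq1 (aT_summable hq0 hq1))
  have h3 : (fun n : ℕ => qP q q n * ∑' j, aT q j * (q ^ n) ^ j) = fun n => eS q 0 := by
    funext n
    exact eS_eq hq0 hq1 n
  rw [h3] at h2
  have h4 := tendsto_nhds_unique h2 tendsto_const_nhds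
  have : aT q 0 = 1 := by simp [aT, qP]
  rw [this, mul_one] at h4
  rw [h4, ← eS_eq hq0 hq1 n]
  have := (qP_pos hq0 hq1 n).ne'
  field_simp

lemma inf_ne {q : ℝ} (hq0 : 0 < q) (hq1 : q < 1) : qPInf q q ≠ 0 := by
  intro h
  have := inf_gS hq0 hq1
  simp [h] at this

lemma Vnat {q : ℝ} (hq0 : 0 < q) (hq1 : q < 1) (n : ℕ) :
    qPInf q q ^ 2 * ∑' j : ℕ, bT q j * (qP q q (j + n))⁻¹ =
      ∑' i : ℕ, (-1) ^ i * q ^ ((i + 1).choose 2) * (q ^ n) ^ i := by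
  have hS : Summable fun p : ℕ × ℕ => bT q p.1 * (aT q p.2 * (q ^ (p.1 + n)) ^ p.2) := by
    have := (bT_summable hq0 hq1).norm.mul_of_nonneg (aT_summable hq0 hq1).norm
      (fun _ => norm_nonneg _) (fun _ => norm_nonneg _)
    refine Summable.of_norm_bounded this fun p => ?_
    rw [norm_mul, norm_mul, Real.norm_of_nonneg (by positivity : 0 ≤ (q ^ (p.1 + n)) ^ p.2)]
    gcongr
    exact mul_le_of_le_one_right (norm_nonneg _) (pow_pow_le hq0 hq1 _ _)
  calc _ = qPInf q q * ∑' j : ℕ, ∑' i : ℕ, bT q j * (aT q i * (q ^ (j + n)) ^ i) := by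
        rw [pow_two, mul_assoc, ← tsum_mul_left]
        congr 1
        refine tsum_congr fun j => ?_
        rw [tsum_mul_left, mul_left_comm, inf_eS hq0 hq1]
        rfl
    _ = qPInf q q * ∑' i : ℕ, ∑' j : ℕ, bT q j * (aT q i * (q ^ (j + n)) ^ i) := by
        rw [Summable.tsum_comm (f := fun i j => bT q j * (aT q i * (q ^ (j + n)) ^ i))]
        exact hS.prod_symm
    _ = ∑' i : ℕ, qPInf q q * (aT q i * (q ^ n) ^ i * gS q i) := by
        rw [← tsum_mul_left]
        refine tsum_congr fun i => ?_
        congr 1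
        unfold gS
        rw [← tsum_mul_left]
        refine tsum_congr fun j => ?_
        ring
    _ = _ := by
        refine tsum_congr fun i => ?_
        rw [gS_eq hq0 hq1]
        have h := inf_gS hq0 hq1
        have h1 := (qP_pos hq0 hq1 i).ne'
        calc _ = (qPInf q q * gS q 0) * (aT q i * qP q q i) * (q ^ n) ^ i := by ring
          _ = _ := by rw [h, aT]; field_simp

def aZ (q : ℝ) (t i : ℤ) : ℝ := (-1 : ℝ) ^ i * q ^ ((i : ℝ) * (i + 1) / 2 + i * t)
def HP (q : ℝ) (t : ℤ) : ℝ := ∑' i : ℤ, if 0 ≤ i then aZ q t i else 0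
def HM (q : ℝ) (t : ℤ) : ℝ := ∑' i : ℤ, if i < 0 then aZ q t i else 0

lemma summable_gauss {q : ℝ} (hq0 : 0 < q) (hq1 : q < 1) {α : ℝ} (hα : 0 < α) (β γ : ℝ) :
    Summable fun i : ℤ => q ^ (α * (i : ℝ) ^ 2 + β * i + γ) := by
  have key : ∀ β : ℝ, Summable fun n : ℕ => q ^ (α * (n : ℝ) ^ 2 + β * n + γ) := by
    intro β
    refine Summable.of_nonneg_of_le (fun n => (Real.rpow_pos_of_pos hq0 _).le) (fun n => ?_)
      ((summable_geometric_of_lt_one hq0.le hq1).mul_left (q ^ (γ - (β - 1) ^ 2 / (4 * α))))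
    rw [← Real.rpow_natCast q, ← Real.rpow_add hq0]
    apply Real.rpow_le_rpow_of_exponent_ge hq0 hq1.le
    have : α * (n : ℝ) ^ 2 + β * n + γ - (γ - (β - 1) ^ 2 / (4 * α) + n)
        = (2 * α * n + (β - 1)) ^ 2 / (4 * α) := by
      field_simp
      ring
    have h2 : 0 ≤ (2 * α * n + (β - 1)) ^ 2 / (4 * α) := by positivity
    linarith
  refine Summable.of_nat_of_neg ?_ ?_
  · simpa using key β
  · refine (key (-β)).congr fun n => ?_
    congr 1
    push_cast
    ring

lemma norm_aZ {q : ℝ} (hq0 : 0 < q) (t i : ℤ) :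
    ‖aZ q t i‖ = q ^ ((i : ℝ) * (i + 1) / 2 + i * t) := by
  unfold aZ
  rw [norm_mul, norm_zpow, norm_neg, norm_one, one_zpow, one_mul,
    Real.norm_of_nonneg (Real.rpow_pos_of_pos hq0 _).le]

lemma aZ_summable {q : ℝ} (hq0 : 0 < q) (hq1 : q < 1) (t : ℤ) : Summable (aZ q t) := by
  apply Summable.of_norm
  refine (summable_gauss hq0 hq1 (α := 1 / 2) (by norm_num) (1 / 2 + t) 0).congr fun i => ?_
  rw [norm_aZ hq0]
  congr 1
  ring

lemma summable_ite' {ι : Type*} {f : ι → ℝ} (hf : Summable f) (P : ι → Prop) [DecidablePred P] :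
    Summable fun i => if P i then f i else 0 := by
  refine Summable.of_norm_bounded hf.norm fun i => ?_
  split_ifs <;> simp

lemma aZ_tsum {q : ℝ} (t : ℤ) : ∑' i, aZ q t i = 0 := by
  have h : ∑' i, aZ q t i = ∑' i, aZ q t (Equiv.subLeft (-1 - 2 * t) i) :=
    ((Equiv.subLeft (-1 - 2 * t)).tsum_eq (aZ q t)).symm
  have h2 : ∀ i, aZ q t (Equiv.subLeft (-1 - 2 * t) i) = - aZ q t i := by
    intro i
    unfold aZ
    simp only [Equiv.subLeft_apply]
    have e1 : (-1 : ℝ) ^ (-1 - 2 * t - i) = - (-1 : ℝ) ^ i := by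
      rcases Int.even_or_odd i with hi | hi
      · rw [hi.neg_one_zpow, Odd.neg_one_zpow]
        obtain ⟨c, rfl⟩ := hi
        exact ⟨-1 - t - c, by ring⟩
      · rw [hi.neg_one_zpow, Even.neg_one_zpow, neg_neg]
        obtain ⟨c, rfl⟩ := hi
        exact ⟨-1 - t - c, by ring⟩
    rw [e1, neg_mul]
    congr 3
    push_cast
    ring
  simp only [h2, tsum_neg] at h
  linarith

lemma HP_eq {q : ℝ} (hq0 : 0 < q) (hq1 : q < 1) (t : ℤ) : HP q t = - HM q t := by
  have hs := aZ_summable hq0 hq1 t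
  have : HP q t + HM q t = 0 := by
    unfold HP HM
    rw [← (summable_ite' hs _).tsum_add (summable_ite' hs _)]
    refine Eq.trans ?_ (aZ_tsum (q := q) t)
    refine tsum_congr fun i => ?_
    by_cases h : 0 ≤ i
    · simp [h, not_lt.mpr h]
    · simp [h, not_le.mp h]
  linarith

lemma HM_eq {q : ℝ} (hq0 : 0 < q) (t : ℤ) : HM q t = - (q ^ (-(t : ℝ)) * HP q (-t)) := by
  unfold HM HP
  rw [← (Equiv.subLeft (-1 : ℤ)).tsum_eq, ← tsum_mul_left, ← tsum_neg]
  refine tsum_congr fun i => ?_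
  simp only [Equiv.subLeft_apply]
  by_cases h : 0 ≤ i
  · rw [if_pos (by omega), if_pos h]
    unfold aZ
    have e1 : (-1 : ℝ) ^ (-1 - i) = - (-1 : ℝ) ^ i := by
      rcases Int.even_or_odd i with hi | hi
      · rw [hi.neg_one_zpow, Odd.neg_one_zpow]
        obtain ⟨c, rfl⟩ := hi
        exact ⟨-1 - c, by ring⟩
      · rw [hi.neg_one_zpow, Even.neg_one_zpow, neg_neg]
        obtain ⟨c, rfl⟩ := hi
        exact ⟨-1 - c, by ring⟩
    rw [e1, neg_mul, mul_left_comm, ← Real.rpow_add hq0]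
    congr 3
    push_cast
    ring
  · rw [if_neg (by omega), if_neg h]
    simp

lemma HP_symm {q : ℝ} (hq0 : 0 < q) (hq1 : q < 1) (t : ℤ) :
    HP q (-t) = q ^ (t : ℝ) * HP q t := by
  rw [HP_eq hq0 hq1, HM_eq hq0]
  simp

lemma HP_nat {q : ℝ} (n : ℕ) :
    HP q n = ∑' i : ℕ, (-1) ^ i * q ^ ((i + 1).choose 2) * (q ^ n) ^ i := by
  unfold HP
  rw [← (Nat.cast_injective (R := ℤ)).tsum_eq]
  · refine tsum_congr fun i => ?_
    rw [if_pos (by omega), aZ, mul_assoc, zpow_natCast, ← pow_mul, ← pow_add, ← Real.rpow_natCast q]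
    congr 2
    push_cast
    rw [Nat.cast_choose_two]
    push_cast
    ring
  · intro i hi
    by_contra h
    apply hi
    simp only
    rw [if_neg]
    intro h0
    exact h ⟨i.toNat, by simp [h0]⟩

lemma Vhat_nat {q : ℝ} (hq0 : 0 < q) (n : ℕ) :
    Vhat q n = q ^ (n : ℝ) * ∑' j : ℕ, bT q j * (qP q q (j + n))⁻¹ := by
  unfold Vhat
  rw [← tsum_mul_left]
  refine tsum_congr fun j => ?_
  rw [invQ, if_pos (by omega), bT]
  have : ((j : ℤ) + (n : ℤ)).toNat = j + n := by omega
  rw [this]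
  push_cast
  rw [Real.rpow_add hq0, Real.rpow_natCast, Real.rpow_natCast]
  ring

lemma Vhat_neg {q : ℝ} (n : ℕ) :
    Vhat q (-(n : ℤ)) = ∑' j : ℕ, bT q j * (qP q q (j + n))⁻¹ := by
  unfold Vhat
  rw [← (add_left_injective n).tsum_eq]
  · refine tsum_congr fun j => ?_
    have : (((j + n : ℕ) : ℤ) + (-(n : ℤ))) = j := by push_cast; ring
    rw [this, invQ, if_pos (by omega), bT]
    simp
    ring
  · intro i hi
    by_contra h
    apply hi
    simp only
    rw [invQ, if_neg]
    · simp
    intro h0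
    exact h ⟨i - n, by simp; omega⟩

lemma V_HP {q : ℝ} (hq0 : 0 < q) (hq1 : q < 1) (s : ℤ) :
    qPInf q q ^ 2 * Vhat q s = HP q (-s) := by
  obtain ⟨n, rfl | rfl⟩ := s.eq_nat_or_neg
  · rw [HP_symm hq0 hq1, Vhat_nat hq0, mul_left_comm, Vnat hq0 hq1, HP_nat]
    simp
  · rw [Vhat_neg, Vnat hq0 hq1, neg_neg, HP_nat]

lemma main_aux {q : ℝ} (hq0 : 0 < q) (hq1 : q < 1) (K c : ℤ) (hK : 0 ≤ K) (A : ℤ → ℝ)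
    (hA : Summable fun j => q ^ A j) (P : ℤ → Prop) [DecidablePred P]
    (hP : ∀ j, P j → 0 ≤ j) (hP' : ∀ j, ¬ P j → j ≤ 0) :
    Summable (fun j => q ^ A j * HP q (K * j - c)) ∧
    (∑' p : ℤ × ℤ, if 0 ≤ p.1 ∧ P p.2 then q ^ A p.2 * aZ q (K * p.2 - c) p.1 else 0) -
    (∑' p : ℤ × ℤ, if p.1 < 0 ∧ ¬ P p.2 then q ^ A p.2 * aZ q (K * p.2 - c) p.1 else 0) =
    ∑' j, q ^ A j * HP q (K * j - c) := by
  have hB : Summable fun p : ℤ × ℤ => ‖aZ q (-c) p.1‖ * q ^ A p.2 :=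
    (aZ_summable hq0 hq1 (-c)).norm.mul_of_nonneg hA (fun _ => norm_nonneg _)
      (fun _ => (Real.rpow_pos_of_pos hq0 _).le)
  have hle : ∀ p : ℤ × ℤ, 0 ≤ p.1 * p.2 →
      ‖q ^ A p.2 * aZ q (K * p.2 - c) p.1‖ ≤ ‖aZ q (-c) p.1‖ * q ^ A p.2 := by
    intro p hp
    rw [norm_mul, mul_comm, Real.norm_of_nonneg (Real.rpow_pos_of_pos hq0 _).le]
    refine mul_le_mul_of_nonneg_right ?_ (Real.rpow_pos_of_pos hq0 _).le
    rw [norm_aZ hq0, norm_aZ hq0]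
    apply Real.rpow_le_rpow_of_exponent_ge hq0 hq1.le
    have h1 : (0 : ℝ) ≤ ((K * (p.1 * p.2) : ℤ) : ℝ) := by exact_mod_cast mul_nonneg hK hp
    push_cast at h1 ⊢
    nlinarith
  have hB0 : ∀ p : ℤ × ℤ, 0 ≤ ‖aZ q (-c) p.1‖ * q ^ A p.2 := fun p =>
    mul_nonneg (norm_nonneg _) (Real.rpow_pos_of_pos hq0 _).le
  have s1 : Summable fun p : ℤ × ℤ =>
      if 0 ≤ p.1 ∧ P p.2 then q ^ A p.2 * aZ q (K * p.2 - c) p.1 else 0 := by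
    refine Summable.of_norm_bounded hB fun p => ?_
    split_ifs with h
    · exact hle p (mul_nonneg h.1 (hP _ h.2))
    · simpa using hB0 p
  have s2 : Summable fun p : ℤ × ℤ =>
      if p.1 < 0 ∧ ¬ P p.2 then q ^ A p.2 * aZ q (K * p.2 - c) p.1 else 0 := by
    refine Summable.of_norm_bounded hB fun p => ?_
    split_ifs with h
    · exact hle p (mul_nonneg_of_nonpos_of_nonpos h.1.le (hP' _ h.2))
    · simpa using hB0 p
  have s3 := (s1.sub s2).prod_symm
  have hin : ∀ j : ℤ, (∑' i : ℤ,
      ((if 0 ≤ i ∧ P j then q ^ A j * aZ q (K * j - c) i else 0) -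
       (if i < 0 ∧ ¬ P j then q ^ A j * aZ q (K * j - c) i else 0)))
       = q ^ A j * HP q (K * j - c) := by
    intro j
    by_cases h : P j
    · rw [HP, ← tsum_mul_left]
      refine tsum_congr fun i => ?_
      simp [h]
    · rw [HP_eq hq0 hq1, HM, ← tsum_neg, ← tsum_mul_left]
      refine tsum_congr fun i => ?_
      simp only [h, not_false_eq_true, and_true, and_false, if_false]
      split_ifs <;> ring
  constructor
  · refine s3.prod.congr fun j => ?_
    rw [← hin j]
    rfl
  · rw [← s1.tsum_sub s2, ← (Equiv.prodComm ℤ ℤ).tsum_eq]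
    refine (s3.tsum_prod).trans ?_
    refine tsum_congr fun j => ?_
    rw [← hin j]
    rfl

/-- The Kac--Peterson and Verma-character bosonic forms of the `ℤ_k`
parafermion characters agree. -/
theorem KacPeterson_eq_Verma_bosonic
    (k : ℕ) (hk : 1 ≤ k) (ℓ : ℤ) (hℓ0 : 0 ≤ ℓ) (hℓk : ℓ ≤ (k : ℤ)) (r m : ℤ)
    (hm : m = ℓ + 2 * r) (q : ℝ) (hq0 : 0 < q) (hq1 : q < 1)
    (f g : ℤ × ℤ → ℝ)
    (hf : f = fun p => (-1 : ℝ) ^ p.1 *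
      q ^ ( (((ℓ : ℝ) + 1 + ((p.1 : ℝ) + 2 * (p.2 : ℝ)) * ((k : ℝ) + 2)) ^ 2) / (4 * ((k : ℝ) + 2))
          - (((m : ℝ) + (p.1 : ℝ) * (k : ℝ)) ^ 2) / (4 * (k : ℝ)) ))
    (hg : g = fun p => (-1 : ℝ) ^ p.1 *
      q ^ ( (((ℓ : ℝ) + 1 - ((p.1 : ℝ) + 2 * (p.2 : ℝ)) * ((k : ℝ) + 2)) ^ 2) / (4 * ((k : ℝ) + 2))
          - (((m : ℝ) + (p.1 : ℝ) * (k : ℝ)) ^ 2) / (4 * (k : ℝ)) )) :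
    ((qPInf q q)⁻¹) ^ 2 *
      ( ( (∑' p : ℤ × ℤ, if 0 ≤ p.1 ∧ 0 ≤ p.2 then f p else 0)
          - ∑' p : ℤ × ℤ, if p.1 < 0 ∧ p.2 < 0 then f p else 0 )
        - ( (∑' p : ℤ × ℤ, if 0 ≤ p.1 ∧ 0 < p.2 then g p else 0)
            - ∑' p : ℤ × ℤ, if p.1 < 0 ∧ p.2 ≤ 0 then g p else 0 ) )
    = q ^ (-(((ℓ : ℝ) + 2 * (r : ℝ)) ^ 2) / (4 * (k : ℝ))) *
        ∑' j : ℤ,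
          q ^ (((k : ℝ) + 2) * ((j : ℝ) + ((ℓ : ℝ) + 1) / (2 * ((k : ℝ) + 2))) ^ 2) *
            (Vhat q (r - ((k : ℤ) + 2) * j) - Vhat q (r + ℓ + 1 + ((k : ℤ) + 2) * j)) := by
  have hk0 : (0 : ℝ) < k := by exact_mod_cast hk
  have hk2 : (0 : ℝ) < (k : ℝ) + 2 := by linarith
  set C : ℝ := q ^ (-(((ℓ : ℝ) + 2 * (r : ℝ)) ^ 2) / (4 * (k : ℝ))) with hC
  set A : ℤ → ℝ := fun j =>
    ((k : ℝ) + 2) * ((j : ℝ) + ((ℓ : ℝ) + 1) / (2 * ((k : ℝ) + 2))) ^ 2 with hA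
  have hAs : Summable fun j => q ^ A j := by
    refine (summable_gauss hq0 hq1 hk2 ((ℓ : ℝ) + 1)
      (((ℓ : ℝ) + 1) ^ 2 / (4 * ((k : ℝ) + 2)))).congr fun j => ?_
    congr 1
    rw [hA]
    field_simp
    ring
  have hAs' : Summable fun j => q ^ A (-j) := (Equiv.neg ℤ).summable_iff.mpr hAs
  have hf' : ∀ p, f p = C * (q ^ A p.2 * aZ q (((k : ℤ) + 2) * p.2 - r) p.1) := by
    intro p
    rw [hf, aZ, hC, hA, hm]
    simp only
    rw [mul_left_comm (q ^ _) ((-1 : ℝ) ^ _), mul_left_comm (q ^ _) ((-1 : ℝ) ^ _),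
      ← Real.rpow_add hq0, ← Real.rpow_add hq0]
    congr 2
    push_cast
    field_simp
    ring
  have hg' : ∀ p, g p = C * (q ^ A (-p.2) * aZ q (((k : ℤ) + 2) * p.2 - (r + ℓ + 1)) p.1) := by
    intro p
    rw [hg, aZ, hC, hA, hm]
    simp only
    rw [mul_left_comm (q ^ _) ((-1 : ℝ) ^ _), mul_left_comm (q ^ _) ((-1 : ℝ) ^ _),
      ← Real.rpow_add hq0, ← Real.rpow_add hq0]
    congr 2
    push_cast
    field_simp
    ring
  obtain ⟨sf, ef⟩ := main_aux hq0 hq1 ((k : ℤ) + 2) r (by omega) A hAs (fun j => 0 ≤ j)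
    (fun _ h => h) (fun _ h => by omega)
  obtain ⟨sg, eg⟩ := main_aux hq0 hq1 ((k : ℤ) + 2) (r + ℓ + 1) (by omega) (fun j => A (-j)) hAs'
    (fun j => 0 < j) (fun _ h => h.le) (fun _ h => by omega)
  simp only [not_le] at ef
  simp only [not_lt] at eg
  have hite : ∀ (Q : Prop) [Decidable Q] (x : ℝ), (if Q then C * x else 0) = C * if Q then x else 0 := by
    intro Q _ x
    split_ifs <;> simp
  simp only [hf', hg', hite, tsum_mul_left, ← mul_sub]
  rw [ef, eg, ← (Equiv.neg ℤ).tsum_eq (fun j => q ^ A (-j) * HP q (((k : ℤ) + 2) * j - (r + ℓ + 1)))]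
  have sg' := (Equiv.neg ℤ).summable_iff.mpr sg
  simp only [Function.comp_def] at sg'
  rw [← sf.tsum_sub sg', mul_left_comm, ← tsum_mul_left]
  congr 1
  refine tsum_congr fun j => ?_
  have h1 := V_HP hq0 hq1 (r - ((k : ℤ) + 2) * j)
  have h2 := V_HP hq0 hq1 (r + ℓ + 1 + ((k : ℤ) + 2) * j)
  have e1 : -(r - ((k : ℤ) + 2) * j) = ((k : ℤ) + 2) * j - r := by ring
  have e2 : -(r + ℓ + 1 + ((k : ℤ) + 2) * j) = ((k : ℤ) + 2) * (-j) - (r + ℓ + 1) := by ring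
  rw [e1] at h1
  rw [e2] at h2
  simp only [Equiv.neg_apply, neg_neg]
  rw [← h1, ← h2]
  change _ = q ^ A j * _
  have h0 := inf_ne hq0 hq1
  field_simp
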